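/- The sequence (m_i), i = 1, 2, ..., is strictly monotone decreasing: m_{i+1} < m_i for every i ≥ 1. -/

import Mathlib

open Polynomial

/-- A real polynomial is hyperbolic if all of its complex roots are real. -/
def Hyperbolic (P : Polynomial ℝ) : Prop :=
  ∀ z : ℂ, Polynomial.aeval z P = 0 → z.im = 0

/-- The `i`-th section `a_0 + a_1 x + ... + a_i x^i` of the coefficient sequence `a`. -/
noncomputable def sect (a : ℕ → ℝ) (i : ℕ) : Polynomial ℝ :=
  ∑ j ∈ Finset.range (i + 1), Polynomial.C (a j) * Polynomial.X ^ j

/-- A polynomial `a_0 + ... + a_n x^n` with all coefficients positive is section-hyperbolic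
if each of its sections of degree `1,...,n` is hyperbolic. -/
def SectionHyperbolic (a : ℕ → ℝ) (n : ℕ) : Prop :=
  (∀ i ≤ n, 0 < a i) ∧ ∀ i, 1 ≤ i → i ≤ n → Hyperbolic (sect a i)

/-- `m_i`: the infimum of `a_i^2/(a_{i-1} a_{i+1})` over all section-hyperbolic polynomials
of degree `i+1`. -/
noncomputable def mSeq (i : ℕ) : ℝ :=
  sInf {r : ℝ | ∃ a : ℕ → ℝ, SectionHyperbolic a (i + 1) ∧
    r = a i ^ 2 / (a (i - 1) * a (i + 1))}

theorem cubic_gain_small {v q : ℝ} (hv : 0 ≤ v) (hv' : v ≤ 23 / 100) (hq : 0 ≤ q)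
    (hq' : q ≤ 8 / 25) :
    3 / 25 * (2 - 3 * v + 4 * v ^ 2 * q) ^ 3 < (1 - 2 * v * q) -
      25 / 3 * v ^ 2 * (1 - 175 / 24 * v * q ^ 2) * (2 - 3 * v + 4 * v ^ 2 * q) := by
  set D := 2 - 3 * v + 4 * v ^ 2 * q with hD
  set d := 2 - 3 * v + 32 / 25 * v ^ 2 with hd
  have hDd : D ≤ d := by nlinarith [sq_nonneg v]
  have hD0 : 0 ≤ D := by nlinarith [mul_nonneg (sq_nonneg v) hq]
  have hvq : v * q ^ 2 ≤ 23 / 100 * (8 / 25) ^ 2 := by gcongr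
  have h1 : 25 / 3 * v ^ 2 * (1 - 175 / 24 * v * q ^ 2) * D ≤
      25 / 3 * v ^ 2 * (1 - 175 / 24 * v * q ^ 2) * d :=
    mul_le_mul_of_nonneg_left hDd (mul_nonneg (by positivity) (by nlinarith))
  have h2 : D ^ 3 ≤ d ^ 3 := by gcongr
  suffices 3 / 25 * d ^ 3 < (1 - 2 * v * q) -
      25 / 3 * v ^ 2 * (1 - 175 / 24 * v * q ^ 2) * d by linarith
  rcases le_total v (1 / 5) with h | h
  · have h3 : 3 / 25 * d ^ 3 + 25 / 3 * v ^ 2 * d + 16 / 25 * v < 1 := by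
      have h3 : d ≤ 2 - 343 / 125 * v := by nlinarith
      have h4 : 0 ≤ d := hD0.trans hDd
      calc 3 / 25 * d ^ 3 + 25 / 3 * v ^ 2 * d + 16 / 25 * v
          ≤ 3 / 25 * (2 - 343 / 125 * v) ^ 3 + 25 / 3 * v ^ 2 * (2 - 343 / 125 * v)
            + 16 / 25 * v := by gcongr
        _ < 1 := by nlinarith [mul_nonneg hv (sub_nonneg.2 h),
            mul_nonneg hv (mul_nonneg hv (sub_nonneg.2 h))]
    have h4 : 0 ≤ v ^ 2 * (v * q ^ 2) * d := by
      have : 0 ≤ d := hD0.trans hDd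
      positivity
    nlinarith
  · have h5 : 137 / 100 ≤ d := by nlinarith
    have h6 : 3 / 25 * d ^ 3 + 25 / 3 * v ^ 2 * d + 61 / 1000 < 1 := by
      have h6 : d ≤ 29 / 20 + 1 / 500 - 12 / 5 * (v - 1 / 5) := by nlinarith
      have h7 : 0 ≤ d := hD0.trans hDd
      calc 3 / 25 * d ^ 3 + 25 / 3 * v ^ 2 * d + 61 / 1000
          ≤ 3 / 25 * (29 / 20 + 1 / 500 - 12 / 5 * (v - 1 / 5)) ^ 3 + 25 / 3 * v ^ 2 *
            (29 / 20 + 1 / 500 - 12 / 5 * (v - 1 / 5)) + 61 / 1000 := by gcongr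
        _ < 1 := by nlinarith [mul_nonneg (sub_nonneg.2 h) (sub_nonneg.2 hv'),
            mul_nonneg (sub_nonneg.2 h) (mul_nonneg (sub_nonneg.2 h) (sub_nonneg.2 hv'))]
    have h7 : 0 ≤ v ^ 3 * q ^ 2 * (d - 137 / 100) := by
      have : 0 ≤ d - 137 / 100 := by linarith
      positivity
    have h8 : 0 ≤ 83 * v ^ 3 * q ^ 2 - 2 * v * q + 61 / 1000 := by
      nlinarith [sq_nonneg (v * q - 3 / 50), mul_nonneg (sub_nonneg.2 h) (sq_nonneg (v * q))]
    nlinarith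

theorem cubic_gain_large {v q : ℝ} (hv : 23 / 100 ≤ v) (hv' : v ≤ 8 / 25)
    (hvq : 4 * v ≤ 1 + 3 * v * q) :
    3 / 25 < (25 / 8 * v) ^ 2 * (25 / 8 * v * (1 - 2 * v * q) -
      25 / 3 * v ^ 2 * (1 - 175 / 24 * v * q ^ 2)) := by
  have expand : (25 / 8 * v) ^ 2 * (25 / 8 * v * (1 - 2 * v * q) -
      25 / 3 * v ^ 2 * (1 - 175 / 24 * v * q ^ 2)) = 625 / 64 * v ^ 3 *
        (25 / 8 - 25 / 4 * (v * q) + 4375 / 72 * (v * q) ^ 2 - 25 / 3 * v) := by ring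
  have hv0 : 0 < v := by linarith
  rw [expand]
  rcases le_total v (3 / 10) with h | h
  · calc 3 / 25 < 625 / 64 * v ^ 3 * (741 / 250 - 25 / 3 * v) := by
          nlinarith [mul_nonneg (sub_nonneg.2 h) (sub_nonneg.2 hv),
            mul_nonneg (sq_nonneg v) (mul_nonneg (sub_nonneg.2 h) (sub_nonneg.2 hv)),
            mul_nonneg hv0.le (mul_nonneg (sub_nonneg.2 h) (sub_nonneg.2 hv))]
      _ ≤ _ := by
          gcongr
          nlinarith [sq_nonneg (v * q - 9 / 175)]
  · have hp : (4 * v - 1) / 3 ≤ v * q := by linarith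
    have hmono : 0 ≤ (v * q - (4 * v - 1) / 3) *
        (4375 / 72 * (v * q + (4 * v - 1) / 3) - 25 / 4) :=
      mul_nonneg (by linarith) (by linarith)
    calc 3 / 25 < 625 / 64 * v ^ 3 * (25 / 8 - 25 / 4 * ((4 * v - 1) / 3) +
            4375 / 72 * ((4 * v - 1) / 3) ^ 2 - 25 / 3 * v) := by
          have h1 : 79 / 50 - 371 / 100 * v ≤ 25 / 8 - 25 / 4 * ((4 * v - 1) / 3) +
              4375 / 72 * ((4 * v - 1) / 3) ^ 2 - 25 / 3 * v := by
            nlinarith [sq_nonneg (v - 31 / 100)]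
          calc 3 / 25 < 625 / 64 * v ^ 3 * (79 / 50 - 371 / 100 * v) := by
                nlinarith [mul_nonneg (sub_nonneg.2 h) (sub_nonneg.2 hv'),
                  mul_nonneg (sq_nonneg v) (mul_nonneg (sub_nonneg.2 h) (sub_nonneg.2 hv')),
                  mul_nonneg hv0.le (mul_nonneg (sub_nonneg.2 h) (sub_nonneg.2 hv'))]
            _ ≤ _ := by gcongr
      _ ≤ _ := by
          refine mul_le_mul_of_nonneg_left ?_ (by positivity)
          nlinarith

theorem gain_gt {u x q : ℝ} (hu : 0 ≤ u) (hu' : u ≤ 1) (hx : 0 ≤ x) (hx' : x ≤ 8 / 25)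
    (hq : 0 ≤ q) (hq' : q ≤ 8 / 25) (hxq : 4 * x ≤ 1 + 3 * x * q)
    (hc : 1 ≤ u * (2 - 3 * (u * x) + 4 * (u * x) ^ 2 * q)) :
    3 / 25 < u ^ 3 * (1 - 2 * (u * x) * q) -
      u ^ 2 * (25 / 3 * (u * x) ^ 2 * (1 - 175 / 24 * (u * x) * q ^ 2)) := by
  have hv : 0 ≤ u * x := by positivity
  have hvx : u * x ≤ x := mul_le_of_le_one_left hx hu'
  have hvu : 25 / 8 * (u * x) ≤ u := by nlinarith
  have hvq : 4 * (u * x) ≤ 1 + 3 * (u * x) * q := by nlinarith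
  generalize u * x = v at *
  have hv1 : v ≤ 8 / 25 := hvx.trans hx'
  have hA : 0 ≤ 1 - 2 * v * q := by nlinarith
  rcases le_total v (23 / 100) with h | h
  · have key := cubic_gain_small hv h hq hq'
    generalize 25 / 3 * v ^ 2 * (1 - 175 / 24 * v * q ^ 2) = B at *
    generalize 1 - 2 * v * q = A at *
    generalize 2 - 3 * v + 4 * v ^ 2 * q = D at *
    have hD : 0 < D := by
      by_contra hD
      nlinarith
    have h1 : A - B * D ≤ u * D * A - B * D := by nlinarith
    have h2 : 0 < A - B * D := lt_trans (by positivity) key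
    have h3 : A - B * D ≤ (u * D) ^ 2 * (u * D * A - B * D) := by
      have : 1 ≤ (u * D) ^ 2 := one_le_pow₀ hc
      nlinarith
    have h4 : D ^ 3 * (3 / 25) < D ^ 3 * (u ^ 3 * A - u ^ 2 * B) := by
      calc _ < A - B * D := by linarith
        _ ≤ _ := h3
        _ = _ := by ring
    exact lt_of_mul_lt_mul_left h4 (by positivity)
  · have key := cubic_gain_large h hv1 hvq
    generalize 25 / 3 * v ^ 2 * (1 - 175 / 24 * v * q ^ 2) = B at *
    generalize 1 - 2 * v * q = A at *
    have h1 : 25 / 8 * v * A - B ≤ u * A - B := by nlinarith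
    have h2 : 0 < 25 / 8 * v * A - B := by
      by_contra h0
      nlinarith [sq_nonneg (25 / 8 * v)]
    have h3 : (25 / 8 * v) ^ 2 ≤ u ^ 2 := by gcongr
    calc _ < _ := key
      _ ≤ u ^ 2 * (u * A - B) := by
        apply mul_le_mul h3 h1 h2.le (by positivity)
      _ = _ := by ring

/-- The normalized sections attached to a sequence `y` of inverse quotients: if
`y j = a j * a (j + 2) / a (j + 1) ^ 2`, then `normSect y n` is the section of degree `n + 1`
of `a`, divided by its leading term and written in the variable `-a n / (a (n + 1) * x)`. -/
def normSect (y : ℕ → ℝ) : ℕ → ℝ → ℝ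
  | 0, u => 1 - u
  | n + 1, u => 1 - u * normSect y n (u * y n)

/-- The derivative of `normSect y n` with respect to its variable. -/
def normSectDeriv (y : ℕ → ℝ) : ℕ → ℝ → ℝ
  | 0, _ => -1
  | n + 1, u => -normSect y n (u * y n) - u * y n * normSectDeriv y n (u * y n)

/-- The derivative of `normSect y n u` with respect to `y` in the direction `j ↦ (3 / 25) ^ j`. -/
noncomputable def normSectVar (y : ℕ → ℝ) : ℕ → ℝ → ℝ
  | 0, _ => 0
  | n + 1, u => -u * normSectVar y n (u * y n) -
      u ^ 2 * (3 / 25) ^ n * normSectDeriv y n (u * y n)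

theorem hasDerivAt_normSect_path (y : ℕ → ℝ) (n : ℕ) {φ : ℝ → ℝ} {d : ℝ}
    (hφ : HasDerivAt φ d 0) :
    HasDerivAt (fun ε => normSect (fun j => y j + ε * (3 / 25) ^ j) n (φ ε))
      (normSectVar y n (φ 0) + d * normSectDeriv y n (φ 0)) 0 := by
  induction n generalizing φ d with
  | zero => simpa [normSect, normSectVar, normSectDeriv] using hφ.const_sub 1
  | succ n ih =>
    have hy : HasDerivAt (fun ε : ℝ => y n + ε * (3 / 25) ^ n) ((3 / 25) ^ n) 0 := by
      simpa using ((hasDerivAt_id (0 : ℝ)).mul_const ((3 / 25 : ℝ) ^ n)).const_add (y n)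
    have h := (hφ.mul (ih (hφ.mul hy))).const_sub 1
    refine h.congr_deriv ?_
    simp only [normSectVar, normSectDeriv, Pi.mul_apply, zero_mul, add_zero]
    ring

theorem hasDerivAt_normSect (y : ℕ → ℝ) (n : ℕ) (u : ℝ) :
    HasDerivAt (normSect y n) (normSectDeriv y n u) u := by
  induction n generalizing u with
  | zero => simpa [normSect, normSectDeriv] using (hasDerivAt_id u).const_sub 1
  | succ n ih =>
    have h1 : HasDerivAt (fun u => u * y n) (y n) u := by
      simpa using (hasDerivAt_id u).mul_const (y n)
    have h := ((hasDerivAt_id u).mul ((ih (u * y n)).comp u h1)).const_sub 1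
    refine h.congr_deriv ?_
    simp only [normSectDeriv, id, Function.comp]
    ring

theorem continuous_normSect_uncurry (n : ℕ) :
    Continuous fun p : (ℕ → ℝ) × ℝ => normSect p.1 n p.2 := by
  induction n with
  | zero => exact continuous_const.sub continuous_snd
  | succ n ih =>
    have h : Continuous fun p : (ℕ → ℝ) × ℝ => (p.1, p.2 * p.1 n) := by fun_prop
    exact continuous_const.sub (continuous_snd.mul (ih.comp h))

theorem mul_mem_of_le_third {y : ℕ → ℝ} (hy : ∀ j, 0 ≤ y j ∧ y j ≤ 1 / 3) {u : ℝ}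
    (hu : 0 ≤ u) (hu' : u ≤ 1) (n : ℕ) :
    0 ≤ u * y n ∧ u * y n ≤ 1 / 3 :=
  ⟨mul_nonneg hu (hy n).1, (mul_le_of_le_one_left (hy n).1 hu').trans (hy n).2⟩

theorem normSect_mem {y : ℕ → ℝ} (hy : ∀ j, 0 ≤ y j ∧ y j ≤ 1 / 3) (n : ℕ)
    {u : ℝ} (hu : 0 ≤ u) (hu' : u ≤ 1) :
    1 - u ≤ normSect y n u ∧ normSect y n u ≤ 1 := by
  induction n generalizing u with
  | zero => simp only [normSect]; constructor <;> linarith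
  | succ n ih =>
    obtain ⟨h0, h1⟩ := mul_mem_of_le_third hy hu hu' n
    obtain ⟨h2, h3⟩ := ih h0 (h1.trans (by norm_num))
    simp only [normSect]
    constructor <;> nlinarith

theorem normSectDeriv_mem {y : ℕ → ℝ} (hy : ∀ j, 0 ≤ y j ∧ y j ≤ 1 / 3) (n : ℕ)
    {u : ℝ} (hu : 0 ≤ u) (hu' : u ≤ 1) :
    -1 ≤ normSectDeriv y n u ∧ normSectDeriv y n u ≤ 0 := by
  induction n generalizing u with
  | zero => simp [normSectDeriv]
  | succ n ih =>
    obtain ⟨h0, h1⟩ := mul_mem_of_le_third hy hu hu' n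
    obtain ⟨h2, h3⟩ := ih h0 (h1.trans (by norm_num))
    obtain ⟨h4, h5⟩ := normSect_mem hy n h0 (h1.trans (by norm_num))
    simp only [normSectDeriv]
    constructor <;> nlinarith

theorem normSect_succ_le {y : ℕ → ℝ} (hy : ∀ j, 0 ≤ y j ∧ y j ≤ 1 / 3) (n : ℕ)
    {u : ℝ} (hu : 0 ≤ u) (hu' : u ≤ 1) :
    normSect y (n + 1) u ≤ 1 - u + u ^ 2 * y n := by
  obtain ⟨h0, h1⟩ := mul_mem_of_le_third hy hu hu' n
  have h4 := (normSect_mem hy n h0 (h1.trans (by norm_num))).1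
  simp only [normSect]
  nlinarith

theorem normSectDeriv_succ_le {y : ℕ → ℝ} (hy : ∀ j, 0 ≤ y j ∧ y j ≤ 1 / 3) (n : ℕ)
    {u : ℝ} (hu : 0 ≤ u) (hu' : u ≤ 1) :
    normSectDeriv y (n + 1) u ≤ -1 + 2 * (u * y n) := by
  obtain ⟨h0, h1⟩ := mul_mem_of_le_third hy hu hu' n
  have h2 := (normSectDeriv_mem hy n h0 (h1.trans (by norm_num))).1
  have h4 := (normSect_mem hy n h0 (h1.trans (by norm_num))).1
  simp only [normSectDeriv]
  nlinarith

theorem normSectDeriv_le {y : ℕ → ℝ} (hy : ∀ j, 0 ≤ y j ∧ y j ≤ 1 / 3) (n : ℕ)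
    {u : ℝ} (hu : 0 ≤ u) (hu' : u ≤ 1) :
    normSectDeriv y n u ≤ -1 + 2 / 3 * u := by
  cases n with
  | zero => simp only [normSectDeriv]; linarith
  | succ n => nlinarith [normSectDeriv_succ_le hy n hu hu', (hy n).2]

theorem normSectVar_succ_mem {y : ℕ → ℝ} (hy : ∀ j, 0 ≤ y j ∧ y j ≤ 1 / 3) (n : ℕ)
    {u : ℝ} (hu : 0 ≤ u) (hu' : u ≤ 1)
    (hvar : normSectVar y n (u * y n) ≤ 25 / 3 * (3 / 25) ^ n * (u * y n) ^ 2) :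
    (3 / 25) ^ n * u ^ 2 * (1 - 2 / 3 * (u * y n) - 25 / 3 * (u * y n) * y n) ≤
        normSectVar y (n + 1) u ∧
      normSectVar y (n + 1) u ≤ (3 / 25) ^ n * u ^ 2 - u * normSectVar y n (u * y n) := by
  obtain ⟨h0, h1⟩ := mul_mem_of_le_third hy hu hu' n
  have h4 := normSectDeriv_le hy n h0 (h1.trans (by norm_num))
  have h5 := (normSectDeriv_mem hy n h0 (h1.trans (by norm_num))).1
  have hr : (0 : ℝ) < (3 / 25) ^ n := by positivity
  simp only [normSectVar]
  generalize normSectVar y n (u * y n) = e at *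
  generalize normSectDeriv y n (u * y n) = d at *
  generalize ((3 : ℝ) / 25) ^ n = r at *
  have h6 : u ^ 2 * r * (1 - 2 / 3 * (u * y n)) ≤ u ^ 2 * r * (-d) := by gcongr; linarith
  have h7 : u ^ 2 * r * (-d) ≤ u ^ 2 * r * 1 := by gcongr; linarith
  have h8 : u * e ≤ u * (25 / 3 * r * (u * y n) ^ 2) := by gcongr
  constructor <;> linarith

theorem normSectVar_mem {y : ℕ → ℝ} (hy : ∀ j, 0 ≤ y j ∧ y j ≤ 1 / 3) (n : ℕ)
    {u : ℝ} (hu : 0 ≤ u) (hu' : u ≤ 1 / 3) :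
    0 ≤ normSectVar y n u ∧ normSectVar y n u ≤ 25 / 3 * (3 / 25) ^ n * u ^ 2 := by
  induction n generalizing u with
  | zero => simp only [normSectVar]; exact ⟨le_rfl, by positivity⟩
  | succ n ih =>
    have hu1 : u ≤ 1 := hu'.trans (by norm_num)
    obtain ⟨h0, h1⟩ := mul_mem_of_le_third hy hu hu1 n
    obtain ⟨h2, h3⟩ := ih h0 h1
    obtain ⟨h4, h5⟩ := normSectVar_succ_mem hy n hu hu1 h3
    have h6 : u * y n ≤ 1 / 9 := by nlinarith [hy n]
    refine ⟨le_trans (mul_nonneg (by positivity) ?_) h4, ?_⟩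
    · nlinarith [hy n]
    · have h7 : 0 ≤ u * normSectVar y n (u * y n) := mul_nonneg hu h2
      rw [pow_succ]
      linarith

theorem le_normSectVar {y : ℕ → ℝ} (hy : ∀ j, 0 ≤ y j ∧ y j ≤ 1 / 3) (h0 : y 0 = 0) (n : ℕ)
    {v : ℝ} (hv : 0 ≤ v) (hv' : v ≤ 8 / 25) (hn : y n ≤ 8 / 25) :
    7 / 8 * (25 / 3) * (3 / 25) ^ n * (v * y n) ^ 2 ≤ normSectVar y n (v * y n) := by
  cases n with
  | zero => simp [h0, normSectVar]
  | succ n =>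
    have hw : 0 ≤ v * y (n + 1) := mul_nonneg hv (hy _).1
    have hw' : v * y (n + 1) ≤ 8 / 25 * (8 / 25) :=
      mul_le_mul hv' hn (hy _).1 (by norm_num)
    generalize v * y (n + 1) = w at *
    have hw1 : w ≤ 1 := hw'.trans (by norm_num)
    obtain ⟨h1, h2⟩ := mul_mem_of_le_third hy hw hw1 n
    refine le_trans ?_ (normSectVar_succ_mem hy n hw hw1 (normSectVar_mem hy n h1 h2).2).1
    have h3 : w * y n ≤ 8 / 25 * (8 / 25) * (1 / 3) :=
      mul_le_mul hw' (hy n).2 (hy n).1 (by norm_num)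
    calc 7 / 8 * (25 / 3) * (3 / 25) ^ (n + 1) * w ^ 2 = (3 / 25) ^ n * w ^ 2 * (7 / 8) := by
          rw [pow_succ]; ring
      _ ≤ _ := by
          gcongr
          nlinarith [hy n]

/-- At a point to the right of the first maximum of `u * normSect y n u`, the variation exceeds
the increment of `y n`. -/
theorem pow_lt_mul_normSectVar {y : ℕ → ℝ} (hy : ∀ j, 0 ≤ y j ∧ y j ≤ 8 / 25) (h0 : y 0 = 0)
    {n : ℕ} (hquot : ∀ j < n, 4 * y (j + 1) ≤ 1 + 3 * y (j + 1) * y j) {u : ℝ} (hu : 0 ≤ u)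
    (hu' : u ≤ 1) (hcrit : normSect y (n + 1) u + u * normSectDeriv y (n + 1) u ≤ 0) :
    (3 / 25) ^ (n + 1) < u * normSectVar y (n + 1) u := by
  have hy' : ∀ j, 0 ≤ y j ∧ y j ≤ 1 / 3 := fun j => ⟨(hy j).1, (hy j).2.trans (by norm_num)⟩
  simp only [normSect, normSectDeriv] at hcrit
  cases n with
  | zero =>
    simp only [h0, normSect, normSectDeriv, normSectVar] at hcrit ⊢
    have h1 : 1 / 2 ≤ u := by linarith
    have h2 : (1 / 2) ^ 3 ≤ u ^ 3 := by gcongr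
    norm_num at h2 ⊢
    linarith
  | succ m =>
    have hv : 0 ≤ u * y (m + 1) := mul_nonneg hu (hy _).1
    have hv' : u * y (m + 1) ≤ 8 / 25 := (mul_le_of_le_one_left (hy _).1 hu').trans (hy _).2
    have hv1 : u * y (m + 1) ≤ 1 := hv'.trans (by norm_num)
    have hT := normSect_succ_le hy' m hv hv1
    have hd := normSectDeriv_succ_le hy' m hv hv1
    obtain ⟨hw, hw'⟩ := mul_mem_of_le_third hy' hv hv1 m
    have hE := (normSectVar_succ_mem hy' m hv hv1 (normSectVar_mem hy' m hw hw').2).2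
    have hE' := le_normSectVar hy' h0 m hv hv' (hy m).2
    have hcrit' : 1 ≤ u * (2 - 3 * (u * y (m + 1)) + 4 * (u * y (m + 1)) ^ 2 * y m) := by
      have h1 : u * normSect y (m + 1) (u * y (m + 1)) ≤ u * _ := mul_le_mul_of_nonneg_left hT hu
      have h2 : u * (u * y (m + 1)) * normSectDeriv y (m + 1) (u * y (m + 1)) ≤ u * (u * y (m + 1)) * _ :=
        mul_le_mul_of_nonneg_left hd (mul_nonneg hu hv)
      linarith
    have key := gain_gt hu hu' (hy _).1 (hy _).2 (hy m).1 (hy m).2 (hquot m (by simp)) hcrit'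
    have hr : (0 : ℝ) < (3 / 25) ^ m := by positivity
    rw [normSectVar]
    simp only [pow_succ _ m, pow_succ _ (m + 1)]
    generalize u * y (m + 1) = v at *
    generalize ((3 : ℝ) / 25) ^ m = r at *
    have h3 : u ^ 2 * normSectVar y (m + 1) v ≤
        u ^ 2 * (r * v ^ 2 - v * (7 / 8 * (25 / 3) * r * (v * y m) ^ 2)) := by
      refine mul_le_mul_of_nonneg_left (hE.trans ?_) (by positivity)
      gcongr
    have h4 : u ^ 3 * (r * (3 / 25)) * normSectDeriv y (m + 1) v ≤
        u ^ 3 * (r * (3 / 25)) * (-1 + 2 * (v * y m)) := by gcongr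
    have h5 := mul_lt_mul_of_pos_left key (show 0 < r * (3 / 25) by positivity)
    linarith

/-- Sequences `0, y 1, ..., y n, 0, 0, ...` satisfying the closed conditions that the inverse
quotients `a (j - 1) * a (j + 1) / a j ^ 2` of a section-hyperbolic polynomial fulfil. -/
def Admissible (n : ℕ) (y : ℕ → ℝ) : Prop :=
  (∀ j, 0 ≤ y j ∧ y j ≤ 1 / 3) ∧ y 0 = 0 ∧ (∀ j, n < j → y j = 0) ∧
    ∀ j < n, 4 * y (j + 1) ≤ 1 + 3 * y (j + 1) * y j ∧
      ∃ u ∈ Set.Icc (0 : ℝ) 1, y (j + 1) ≤ u * normSect y (j + 1) u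

theorem isCompact_admissible (n : ℕ) : IsCompact {y | Admissible n y} := by
  have hbox : IsCompact (Set.univ.pi fun _ : ℕ => Set.Icc (0 : ℝ) (1 / 3)) :=
    isCompact_univ_pi fun _ => isCompact_Icc
  have hclosed : IsClosed {y : ℕ → ℝ | y 0 = 0 ∧ (∀ j, n < j → y j = 0) ∧
      ∀ j < n, 4 * y (j + 1) ≤ 1 + 3 * y (j + 1) * y j ∧
        ∃ u ∈ Set.Icc (0 : ℝ) 1, y (j + 1) ≤ u * normSect y (j + 1) u} := by
    simp only [Set.ofPred_and, Set.ofPred_forall]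
    refine (isClosed_eq (by fun_prop) (by fun_prop)).inter (IsClosed.inter ?_ ?_)
    · exact isClosed_iInter fun j => isClosed_iInter fun _ =>
        isClosed_eq (by fun_prop) (by fun_prop)
    · refine isClosed_iInter fun j => isClosed_iInter fun _ => IsClosed.inter ?_ ?_
      · exact isClosed_le (by fun_prop) (by fun_prop)
      · have hset : IsClosed {p : (ℕ → ℝ) × Set.Icc (0 : ℝ) 1 |
            p.1 (j + 1) ≤ p.2 * normSect p.1 (j + 1) p.2} := by
          refine isClosed_le (by fun_prop) (Continuous.mul (by fun_prop) ?_)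
          exact (continuous_normSect_uncurry (j + 1)).comp
            (f := fun p : (ℕ → ℝ) × Set.Icc (0 : ℝ) 1 => (p.1, (p.2 : ℝ))) (by fun_prop)
        convert isClosedMap_fst_of_compactSpace _ hset using 1
        ext y
        simp
  convert hbox.inter_right hclosed using 1
  ext y
  simp only [Admissible, Set.mem_inter_iff, Set.mem_univ_pi, Set.mem_Icc, Set.mem_ofPred_eq]

theorem Admissible.le {n : ℕ} {y : ℕ → ℝ} (h : Admissible n y) (j : ℕ) : y j ≤ 8 / 25 := by
  obtain ⟨hy, h0, htail, hstep⟩ := h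
  rcases j with _ | _ | m
  · rw [h0]; norm_num
  · rcases lt_or_ge n 1 with hn | hn
    · rw [htail _ (by omega)]; norm_num
    · have := (hstep 0 (by omega)).1
      rw [h0] at this
      norm_num at this ⊢
      linarith
  rcases lt_or_ge n (m + 2) with hn | hn
  · rw [htail _ (by omega)]; norm_num
  obtain ⟨u, ⟨hu, hu'⟩, hle⟩ := (hstep (m + 1) (by omega)).2
  have hq := (hstep m (by omega)).1
  obtain ⟨hv, hv'⟩ := mul_mem_of_le_third hy hu hu' (m + 1)
  have hv1 : u * y (m + 1) ≤ 1 := hv'.trans (by norm_num)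
  obtain ⟨hw, hw'⟩ := mul_mem_of_le_third hy hv hv1 m
  have hw2 : u * y (m + 1) * y m ≤ 1 / 3 * (1 / 3) := mul_le_mul hv' (hy m).2 (hy m).1 (by norm_num)
  have hT : normSect y m (u * y (m + 1) * y m) ≤ 1 - 26 / 27 * (u * y (m + 1) * y m) := by
    generalize u * y (m + 1) * y m = w at *
    cases m with
    | zero => simp only [normSect]; linarith
    | succ m =>
      have := normSect_succ_le hy m hw (hw'.trans (by norm_num))
      nlinarith [hy m]
  simp only [normSect] at hle
  obtain ⟨hx, hx'⟩ := hy (m + 1)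
  have hq0 := hy m
  generalize normSect y m (u * y (m + 1) * y m) = t at *
  have h1 : y (m + 1 + 1) ≤ u - u ^ 2 + u ^ 3 * y (m + 1) *
      (1 - 26 / 27 * (u * y (m + 1) * y m)) := by
    have : u ^ 3 * y (m + 1) * t ≤ u ^ 3 * y (m + 1) * _ :=
      mul_le_mul_of_nonneg_left hT (by positivity)
    linarith
  generalize y (m + 1 + 1) = z at *
  generalize y (m + 1) = x at *
  generalize y m = q at *
  have h2 : z ≤ u - u ^ 2 + u ^ 3 * x - 26 / 81 * u ^ 4 * x * (4 * x - 1) := by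
    have : 0 ≤ u ^ 4 * x * (1 + 3 * x * q - 4 * x) := mul_nonneg (by positivity) (by linarith)
    linarith
  have h3 : u ^ 3 * x - 26 / 81 * u ^ 4 * x * (4 * x - 1) ≤ u ^ 3 / 3 - 26 / 729 * u ^ 4 := by
    have h4 : 0 ≤ u ^ 3 * (1 / 3 - x) * (1 - 26 / 81 * u * (4 * x + 1 / 3)) := by
      refine mul_nonneg (mul_nonneg (by positivity) (by linarith)) ?_
      nlinarith
    linarith
  have h5 : u - u ^ 2 + u ^ 3 / 3 - 26 / 729 * u ^ 4 ≤ 8 / 25 := by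
    nlinarith [sq_nonneg (u - 3 / 4), mul_nonneg hu (sq_nonneg (u - 3 / 4)), sq_nonneg (u ^ 2 - 9 / 16),
      mul_nonneg (sub_nonneg.2 hu') (sq_nonneg (u - 3 / 4))]
  linarith

theorem Admissible.exists_crit {n : ℕ} {y : ℕ → ℝ} (h : Admissible n y) {j : ℕ} (hj : j < n) :
    ∃ u ∈ Set.Icc (0 : ℝ) 1, y (j + 1) ≤ u * normSect y (j + 1) u ∧
      normSect y (j + 1) u + u * normSectDeriv y (j + 1) u ≤ 0 := by
  obtain ⟨hy, h0, htail, hstep⟩ := h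
  have hd (u : ℝ) : HasDerivAt (fun u => u * normSect y (j + 1) u)
      (normSect y (j + 1) u + u * normSectDeriv y (j + 1) u) u := by
    exact ((hasDerivAt_id u).mul (hasDerivAt_normSect y (j + 1) u)).congr_deriv (by simp)
  obtain ⟨u, hu, hmax⟩ := isCompact_Icc.exists_isMaxOn (Set.nonempty_Icc.2 zero_le_one)
    (f := fun u => u * normSect y (j + 1) u)
    (fun u _ => (hd u).continuousAt.continuousWithinAt)
  obtain ⟨w, hw, hle⟩ := (hstep j hj).2
  refine ⟨u, hu, hle.trans (hmax hw), ?_⟩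
  rcases hu.2.lt_or_eq with hu1 | hu1
  · have hpos : 0 < u := by
      refine lt_of_le_of_ne hu.1 fun hu0 => ?_
      have h1 := hmax (show (1 / 2 : ℝ) ∈ Set.Icc (0 : ℝ) 1 by norm_num)
      have h2 := (normSect_mem hy (j + 1) (u := 1 / 2) (by norm_num) (by norm_num)).1
      simp only [Set.mem_ofPred_eq, ← hu0] at h1
      linarith
    exact ((hmax.isLocalMax (Icc_mem_nhds hpos hu1)).hasDerivAt_eq_zero (hd u)).le
  · subst hu1
    have h1 := (normSect_mem hy j (hy j).1 ((hy j).2.trans (by norm_num))).1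
    have h2 := (normSectDeriv_mem hy j (hy j).1 ((hy j).2.trans (by norm_num))).1
    simp only [normSect, normSectDeriv, one_mul]
    nlinarith [hy j]

theorem HasDerivAt.eventually_pos_right {f : ℝ → ℝ} {d : ℝ} (hf : HasDerivAt f d 0)
    (hd : 0 < d) (h0 : 0 ≤ f 0) : ∀ᶠ ε in nhdsWithin (0 : ℝ) (Set.Ioi 0), 0 < f ε := by
  have h1 := (hasDerivAt_iff_tendsto_slope.1 hf).mono_left
    (nhdsWithin_mono (0 : ℝ) (fun x (hx : x ∈ Set.Ioi (0 : ℝ)) => (ne_of_gt hx : x ≠ 0)))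
  filter_upwards [h1.eventually (lt_mem_nhds hd), self_mem_nhdsWithin] with ε hε hpos
  rw [slope_def_field, sub_zero] at hε
  have := (div_pos_iff_of_pos_right (Set.mem_Ioi.1 hpos)).1 hε
  linarith

/-- An admissible sequence can be perturbed to one satisfying strict inequalities and having
larger entries. -/
theorem Admissible.exists_perturbation {n : ℕ} {y : ℕ → ℝ} (h : Admissible n y) :
    ∃ z : ℕ → ℝ, (∀ j, 0 < z j ∧ z j ≤ 1 / 3) ∧ y n < z n ∧
      ∀ j ≤ n, ∃ u ∈ Set.Icc (0 : ℝ) 1, z j < u * normSect z j u := by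
  have hev : ∀ j ≤ n, ∀ᶠ ε in nhdsWithin (0 : ℝ) (Set.Ioi 0), ∃ u ∈ Set.Icc (0 : ℝ) 1,
      y j + ε * (3 / 25) ^ j < u * normSect (fun j => y j + ε * (3 / 25) ^ j) j u := by
    intro j hj
    cases j with
    | zero =>
      filter_upwards [Ioo_mem_nhdsGT (show (0 : ℝ) < 1 / 4 by norm_num)] with ε hε
      refine ⟨1 / 2, by norm_num, ?_⟩
      simp only [h.2.1, normSect]
      have := hε.2
      norm_num at this ⊢
      linarith
    | succ j =>
      obtain ⟨u, hu, hle, hcrit⟩ := h.exists_crit hj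
      have hgain := pow_lt_mul_normSectVar (fun i => ⟨(h.1 i).1, h.le i⟩) h.2.1
        (fun i hi => (h.2.2.2 i (by omega)).1) hu.1 hu.2 hcrit
      have hy : HasDerivAt (fun ε : ℝ => y (j + 1) + ε * (3 / 25) ^ (j + 1))
          ((3 / 25) ^ (j + 1)) 0 := by
        simpa using ((hasDerivAt_id (0 : ℝ)).mul_const ((3 / 25 : ℝ) ^ (j + 1))).const_add
          (y (j + 1))
      have hT := ((hasDerivAt_normSect_path y (j + 1) (hasDerivAt_const 0 u)).const_mul u).sub hy
      have := hT.eventually_pos_right (by simpa using hgain) (by simpa using hle)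
      filter_upwards [this] with ε hε
      exact ⟨u, hu, by simpa using hε⟩
  have hall := (Filter.eventually_all_finite (Set.finite_Iic n)).2 hev
  obtain ⟨ε, hε, hε0, hε1⟩ :=
    (hall.and (Ioo_mem_nhdsGT (show (0 : ℝ) < 1 / 3 - 8 / 25 by norm_num))).exists
  refine ⟨fun j => y j + ε * (3 / 25) ^ j, fun j => ⟨?_, ?_⟩, ?_, hε⟩
  · have := (h.1 j).1
    positivity
  · have h1 : ((3 : ℝ) / 25) ^ j ≤ 1 := pow_le_one₀ (by norm_num) (by norm_num)
    nlinarith [h.le j]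
  · have : 0 < ε * (3 / 25) ^ n := by positivity
    simpa using this

theorem eval_sect_succ (a : ℕ → ℝ) (n : ℕ) (x : ℝ) :
    (sect a (n + 1)).eval x = (sect a n).eval x + a (n + 1) * x ^ (n + 1) := by
  simp [sect, Finset.sum_range_succ _ (n + 1)]

theorem eval_sect_zero (a : ℕ → ℝ) (n : ℕ) : (sect a n).eval 0 = a 0 := by
  induction n with
  | zero => simp [sect]
  | succ n ih => simp [eval_sect_succ, ih]

theorem coeff_sect (a : ℕ → ℝ) {n k : ℕ} (hk : k ≤ n) : (sect a n).coeff k = a k := by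
  simp [sect, Polynomial.finsetSum_coeff, Polynomial.coeff_C_mul, Polynomial.coeff_X_pow, hk]

theorem natDegree_sect_le (a : ℕ → ℝ) (n : ℕ) : (sect a n).natDegree ≤ n :=
  Polynomial.natDegree_sum_le_of_forall_le _ _ fun _ hj =>
    (Polynomial.natDegree_C_mul_X_pow_le _ _).trans (Nat.lt_succ_iff.1 (Finset.mem_range.1 hj))

theorem eval_sect_neg {a x : ℕ → ℝ} {n : ℕ} (ha : ∀ k ≤ n + 1, 0 < a k)
    (hx : ∀ k < n, x k = a k * a (k + 2) / a (k + 1) ^ 2) {t : ℝ} (ht : t ≠ 0) :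
    (sect a (n + 1)).eval (-t) =
      (-1) ^ (n + 1) * (a (n + 1) * t ^ (n + 1) * normSect x n (a n / (a (n + 1) * t))) := by
  induction n with
  | zero =>
    have := (ha 1 le_rfl).ne'
    simp only [sect, normSect]
    simp [Finset.sum_range_succ]
    field_simp
    ring
  | succ n ih =>
    have h1 := (ha (n + 1) (by omega)).ne'
    have h2 := (ha (n + 2) (by omega)).ne'
    have hu : a (n + 1) / (a (n + 1 + 1) * t) * x n = a n / (a (n + 1) * t) := by
      rw [hx n (by omega)]
      field_simp
    rw [eval_sect_succ, ih (fun k hk => ha k (by omega)) (fun k hk => hx k (by omega))]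
    simp only [normSect, hu]
    rw [neg_pow t]
    field_simp
    ring

theorem hyperbolic_of_alternating {P : ℝ[X]} {m : ℕ} (hdeg : P.natDegree ≤ m) {t : ℕ → ℝ}
    (ht : ∀ j < m, t j < t (j + 1)) (hs : ∀ j ≤ m, 0 < (-1) ^ j * P.eval (-t j)) :
    Hyperbolic P := by
  have hroot : ∀ j < m, ∃ r, t j < r ∧ r < t (j + 1) ∧ P.eval (-r) = 0 := by
    intro j hj
    have hcont : ContinuousOn (fun r => (-1) ^ j * P.eval (-r)) (Set.Icc (t j) (t (j + 1))) := by
      fun_prop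
    have h0 := hs j hj.le
    have h1 := hs (j + 1) hj
    obtain ⟨r, hr, hr0⟩ := intermediate_value_Ioo' (ht j hj).le hcont
      (show (0 : ℝ) ∈ _ from ⟨by rw [pow_succ] at h1; linarith, h0⟩)
    exact ⟨r, hr.1, hr.2, by simpa using hr0⟩
  choose! r hr hr' hr0 using hroot
  have hmono : ∀ i j, i ≤ j → j ≤ m → t i ≤ t j := by
    intro i j hij
    induction j, hij using Nat.le_induction with
    | base => simp
    | succ j _ ih => exact fun hj => (ih (by omega)).trans (ht j (by omega)).le
  have hinj : Set.InjOn (fun j => -r j) (Finset.range m : Set ℕ) := by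
    have hlt : ∀ i j, i < j → j < m → r i < r j := fun i j hij hj =>
      (hr' i (by omega)).trans_le ((hmono (i + 1) j hij hj.le).trans (hr j hj).le)
    intro i hi j hj hij
    simp only [Finset.coe_range, Set.mem_Iio, neg_inj] at hi hj hij
    rcases lt_trichotomy i j with h | h | h
    · exact absurd hij (hlt i j h hj).ne
    · exact h
    · exact absurd hij (hlt j i h hi).ne'
  have hP : P ≠ 0 := by
    rintro rfl
    simpa using hs 0 (Nat.zero_le m)
  have hcard : m ≤ P.roots.card := by
    calc m = ((Finset.range m).image fun j => -r j).card := by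
          rw [Finset.card_image_of_injOn hinj, Finset.card_range]
      _ ≤ P.roots.toFinset.card := Finset.card_le_card fun x hx => by
          obtain ⟨j, hj, rfl⟩ := Finset.mem_image.1 hx
          simpa [hP] using hr0 j (Finset.mem_range.1 hj)
      _ ≤ P.roots.card := P.roots.toFinset_card_le
  have hsplit : P.Splits :=
    Polynomial.splits_iff_card_roots.2 (le_antisymm P.card_roots' (hdeg.trans hcard))
  intro z hz
  have hz' : z ∈ (P.map (algebraMap ℝ ℂ)).roots := by
    rw [Polynomial.mem_roots (Polynomial.map_ne_zero hP), Polynomial.IsRoot,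
      Polynomial.eval_map_algebraMap]
    exact hz
  rw [hsplit.roots_map] at hz'
  obtain ⟨x, -, rfl⟩ := Multiset.mem_map.1 hz'
  simp

theorem sign_mul_eval_sect_pos {a : ℕ → ℝ} {j : ℕ} {t s : ℝ} (hj : s * (-1) ^ j = 1)
    (hpos : ∀ k, 0 ≤ a k * t ^ k)
    (hanti : ∀ k, j < k → a (k + 1) * t ^ (k + 1) ≤ a k * t ^ k)
    (h0 : a (j + 1) * t ^ (j + 1) < s * (sect a j).eval (-t)) (d : ℕ) :
    0 < s * (sect a (j + d)).eval (-t) := by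
  have hodd (k : ℕ) : s * (sect a (j + 2 * k + 1)).eval (-t) =
      s * (sect a (j + 2 * k)).eval (-t) - a (j + 2 * k + 1) * t ^ (j + 2 * k + 1) := by
    rw [eval_sect_succ, neg_pow t, pow_succ (-1 : ℝ), pow_add (-1 : ℝ), pow_mul]
    linear_combination (-a (j + 2 * k + 1) * t ^ (j + 2 * k + 1)) * hj
  have heven (k : ℕ) : s * (sect a (j + 2 * k + 1 + 1)).eval (-t) =
      s * (sect a (j + 2 * k + 1)).eval (-t) +
        a (j + 2 * k + 1 + 1) * t ^ (j + 2 * k + 1 + 1) := by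
    rw [eval_sect_succ, neg_pow t, pow_succ (-1 : ℝ), pow_succ (-1 : ℝ), pow_add (-1 : ℝ), pow_mul]
    linear_combination (a (j + 2 * k + 1 + 1) * t ^ (j + 2 * k + 1 + 1)) * hj
  have key (k : ℕ) : a (j + 2 * k + 1) * t ^ (j + 2 * k + 1) <
      s * (sect a (j + 2 * k)).eval (-t) := by
    induction k with
    | zero => simpa using h0
    | succ k ih =>
      have h1 := hanti (j + 2 * k + 1 + 1) (by omega)
      have h2 := hodd k
      have h3 := heven k
      rw [show j + 2 * (k + 1) = j + 2 * k + 1 + 1 by ring]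
      linarith
  rcases d.even_or_odd' with ⟨k, rfl | rfl⟩
  · exact (hpos _).trans_lt (key k)
  · rw [← add_assoc, hodd]
    linarith [key k]

/-- Coefficients with inverse quotients `z`. -/
noncomputable def coeffOfQuot (z : ℕ → ℝ) (k : ℕ) : ℝ :=
  ∏ i ∈ Finset.range k, ∏ l ∈ Finset.range i, z l

theorem coeffOfQuot_pos {z : ℕ → ℝ} (hz : ∀ j, 0 < z j) (k : ℕ) : 0 < coeffOfQuot z k :=
  Finset.prod_pos fun _ _ => Finset.prod_pos fun _ _ => hz _

theorem coeffOfQuot_succ (z : ℕ → ℝ) (k : ℕ) :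
    coeffOfQuot z (k + 1) = coeffOfQuot z k * ∏ l ∈ Finset.range k, z l :=
  Finset.prod_range_succ _ _

theorem coeffOfQuot_quot {z : ℕ → ℝ} (hz : ∀ j, 0 < z j) (k : ℕ) :
    z k = coeffOfQuot z k * coeffOfQuot z (k + 2) / coeffOfQuot z (k + 1) ^ 2 := by
  have h1 := (coeffOfQuot_pos hz k).ne'
  have h2 : ∏ l ∈ Finset.range k, z l ≠ 0 := (Finset.prod_pos fun _ _ => hz _).ne'
  rw [coeffOfQuot_succ z (k + 1), coeffOfQuot_succ z k, Finset.prod_range_succ]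
  field_simp

theorem hyperbolic_sect_coeffOfQuot {z w : ℕ → ℝ} (hz : ∀ j, 0 < z j ∧ z j ≤ 1 / 3) {m : ℕ}
    (hw : ∀ k, 0 < w k ∧ w k ≤ 1) (hlt : ∀ k < m, z k < w k * normSect z k (w k))
    (hm : w m < 1) : Hyperbolic (sect (coeffOfQuot z) (m + 1)) := by
  have hz0 : ∀ j, 0 < z j := fun j => (hz j).1
  have hz' : ∀ j, 0 ≤ z j ∧ z j ≤ 1 / 3 := fun j => ⟨(hz j).1.le, (hz j).2⟩
  have ha := coeffOfQuot_pos hz0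
  have hsucc := coeffOfQuot_succ z
  have hquot := coeffOfQuot_quot hz0
  set a := coeffOfQuot z
  set q : ℕ → ℝ := fun k => ∏ l ∈ Finset.range k, z l with hq
  have hq0 : ∀ k, 0 < q k := fun k => Finset.prod_pos fun _ _ => hz0 _
  have hqs : ∀ k, q (k + 1) = q k * z k := fun k => Finset.prod_range_succ _ _
  have hqanti : Antitone q := antitone_nat_of_succ_le fun k => by
    rw [hqs]
    exact mul_le_of_le_one_right (hq0 k).le ((hz k).2.trans (by norm_num))
  have hzw : ∀ k < m, z k < w k := fun k hk => (hlt k hk).trans_le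
    (mul_le_of_le_one_right (hw k).1.le (normSect_mem hz' k (hw k).1.le (hw k).2).2)
  have heval (k : ℕ) : (sect a (k + 1)).eval (-(1 / (q k * w k))) = (-1) ^ (k + 1) *
      (a (k + 1) * (1 / (q k * w k)) ^ (k + 1) * normSect z k (w k)) := by
    have h1 := hq0 k
    have h2 := (hw k).1
    rw [eval_sect_neg (fun k _ => ha k) (fun k _ => hquot k) (by positivity)]
    congr 3
    have := ha k
    rw [hsucc]
    change a k / (a k * q k * _) = _
    field_simp
  let t : ℕ → ℝ := fun j => Nat.casesOn j 0 fun k => 1 / (q k * w k)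
  refine hyperbolic_of_alternating (natDegree_sect_le _ _) (t := t) ?_ ?_
  · rintro (_ | k) hk
    · have h1 := hq0 0
      have h2 := (hw 0).1
      change 0 < 1 / (q 0 * w 0)
      positivity
    · have h1 := hq0 k
      have h2 := (hw k).1
      have h3 := (hw (k + 1)).1
      have h4 := hz0 k
      change 1 / (q k * w k) < 1 / (q (k + 1) * w (k + 1))
      rw [hqs]
      refine one_div_lt_one_div_of_lt (by positivity) ?_
      rw [mul_assoc]
      refine mul_lt_mul_of_pos_left ?_ h1
      exact (mul_le_of_le_one_right h4.le (hw (k + 1)).2).trans_lt (hzw k (by omega))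
  · rintro (_ | k) hk
    · change 0 < (-1) ^ 0 * (sect a (m + 1)).eval (-0)
      simpa [eval_sect_zero] using ha 0
    · change 0 < (-1) ^ (k + 1) * (sect a (m + 1)).eval (-(1 / (q k * w k)))
      have h1 := hq0 k
      have h2 := (hw k).1
      have h3 := ha (k + 1)
      have hsq : ((-1 : ℝ) ^ (k + 1)) * (-1) ^ (k + 1) = 1 := by
        rw [← mul_pow]; norm_num
      rcases (show k = m ∨ k < m by omega) with rfl | hkm
      · rw [heval, ← mul_assoc, hsq, one_mul]
        have := (normSect_mem hz' k (hw k).1.le (hw k).2).1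
        have : 0 < normSect z k (w k) := by linarith
        positivity
      · have hb : ∀ i, a (i + 1) * (1 / (q k * w k)) ^ (i + 1) =
            a i * (1 / (q k * w k)) ^ i * (q i / (q k * w k)) := by
          intro i
          rw [hsucc]
          change a i * q i * _ = _
          ring
        obtain ⟨d, rfl⟩ := Nat.exists_eq_add_of_lt hkm
        rw [show k + d + 1 + 1 = k + 1 + (d + 1) by ring]
        refine sign_mul_eval_sect_pos hsq (fun i => ?_) (fun i hi => ?_) ?_ _
        · have := ha i
          positivity
        · rw [hb]
          have := ha i
          refine mul_le_of_le_one_right (by positivity) ?_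
          rw [div_le_one (by positivity)]
          refine (hqanti (show k + 1 ≤ i by omega)).trans ?_
          rw [hqs]
          exact mul_le_mul_of_nonneg_left (hzw k hkm).le h1.le
        · rw [heval, ← mul_assoc, hsq, one_mul, hb]
          refine mul_lt_mul_of_pos_left ?_ (by positivity)
          rw [hqs, mul_div_mul_left _ _ h1.ne', div_lt_iff₀ h2, mul_comm]
          exact hlt k hkm

theorem sectionHyperbolic_coeffOfQuot {z : ℕ → ℝ} (hz : ∀ j, 0 < z j ∧ z j ≤ 1 / 3) {n : ℕ}
    (h : ∀ j ≤ n, ∃ u ∈ Set.Icc (0 : ℝ) 1, z j < u * normSect z j u) :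
    SectionHyperbolic (coeffOfQuot z) (n + 2) := by
  refine ⟨fun i _ => coeffOfQuot_pos (fun j => (hz j).1) i, fun i hi hin => ?_⟩
  obtain ⟨m, rfl⟩ := Nat.exists_eq_add_of_le' hi
  choose! u hu hlt using h
  refine hyperbolic_sect_coeffOfQuot hz (w := fun k => if k < m then u k else 1 / 2)
    (fun k => ?_) (fun k hk => ?_) (by norm_num)
  · split_ifs with hk
    · have h1 := hlt k (by omega)
      refine ⟨(hu k (by omega)).1.lt_of_ne fun h0 => ?_, (hu k (by omega)).2⟩
      rw [← h0, zero_mul] at h1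
      exact absurd h1 (hz k).1.le.not_gt
    · norm_num
  · simpa only [if_pos hk] using hlt k (by omega)

theorem Multiset.esymm_cons {R : Type*} [CommSemiring R] (a : R) (s : Multiset R) (n : ℕ) :
    (a ::ₘ s).esymm (n + 1) = s.esymm (n + 1) + a * s.esymm n := by
  simp [Multiset.esymm, Multiset.powersetCard_cons, Multiset.map_map,
    Multiset.sum_map_mul_left]

theorem Multiset.esymm_zero_right {R : Type*} [CommSemiring R] (s : Multiset R) :
    s.esymm 0 = 1 := by
  simp [Multiset.esymm]

theorem Multiset.esymm_zero_succ {R : Type*} [CommSemiring R] (n : ℕ) :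
    (0 : Multiset R).esymm (n + 1) = 0 := by
  rw [Multiset.esymm, Multiset.powersetCard_eq_empty _ (by simp)]
  simp

theorem sum_eq_esymm_one (T : Multiset ℝ) : T.sum = T.esymm 1 := by
  simp [Multiset.esymm, Multiset.powersetCard_one, Multiset.map_map]

theorem sum_sq_eq_esymm (T : Multiset ℝ) :
    (T.map fun t => t ^ 2).sum = T.esymm 1 ^ 2 - 2 * T.esymm 2 := by
  induction T using Multiset.induction_on with
  | empty => simp [Multiset.esymm_zero_succ]
  | cons t T ih =>
    simp only [Multiset.map_cons, Multiset.sum_cons, ih, Multiset.esymm_cons,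
      Multiset.esymm_zero_right]
    ring

theorem sum_cube_eq_esymm (T : Multiset ℝ) : (T.map fun t => t ^ 3).sum =
    T.esymm 1 ^ 3 - 3 * T.esymm 1 * T.esymm 2 + 3 * T.esymm 3 := by
  induction T using Multiset.induction_on with
  | empty => simp [Multiset.esymm_zero_succ]
  | cons t T ih =>
    simp only [Multiset.map_cons, Multiset.sum_cons, ih, Multiset.esymm_cons,
      Multiset.esymm_zero_right]
    ring

theorem four_mul_esymm_two_sq_le {T : Multiset ℝ} (hT : ∀ t ∈ T, 0 ≤ t) (h : 0 < T.esymm 1) :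
    4 * T.esymm 2 ^ 2 ≤ T.esymm 1 ^ 2 * T.esymm 2 + 3 * T.esymm 1 * T.esymm 3 := by
  have key (c : ℝ) : 0 ≤ (T.map fun t => t ^ 3).sum - 2 * c * (T.map fun t => t ^ 2).sum +
      c ^ 2 * T.sum := by
    have h1 : 0 ≤ (T.map fun t => t * (t - c) ^ 2).sum :=
      Multiset.sum_nonneg fun x hx => by
        obtain ⟨t, ht, rfl⟩ := Multiset.mem_map.1 hx
        exact mul_nonneg (hT t ht) (sq_nonneg _)
    have h2 (t : ℝ) : t * (t - c) ^ 2 = t ^ 3 + -(2 * c) * t ^ 2 + c ^ 2 * t := by ring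
    have h3 : (T.map fun t => c ^ 2 * t).sum = c ^ 2 * T.sum := by
      rw [Multiset.sum_map_mul_left, Multiset.map_id']
    simp only [h2, Multiset.sum_map_add, h3] at h1
    rw [Multiset.sum_map_mul_left] at h1
    linarith
  rw [sum_cube_eq_esymm, sum_sq_eq_esymm, sum_eq_esymm_one] at key
  set e := T.esymm 1
  have h1 := mul_nonneg h.le (key ((e ^ 2 - 2 * T.esymm 2) / e))
  field_simp at h1
  linarith

theorem exists_esymm_two_le_mul {T : Multiset ℝ} (hT : ∀ t ∈ T, 0 < t) (h : 0 < T.esymm 1)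
    (h3 : 3 * T.esymm 2 ≤ T.esymm 1 ^ 2) : ∃ t ∈ T, T.esymm 2 ≤ t * T.esymm 1 := by
  by_contra! hlt
  have hne : T ≠ 0 := by
    rintro rfl
    simp [Multiset.esymm_zero_succ] at h
  have h1 : (T.map fun t => t ^ 2).sum < (T.map fun t => t * (T.esymm 2 / T.esymm 1)).sum := by
    refine Multiset.sum_lt_sum_of_nonempty hne fun t ht => ?_
    rw [sq]
    exact mul_lt_mul_of_pos_left ((lt_div_iff₀ h).2 (hlt t ht)) (hT t ht)
  rw [Multiset.sum_map_mul_right, Multiset.map_id', sum_sq_eq_esymm, sum_eq_esymm_one,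
    mul_div_cancel₀ _ h.ne'] at h1
  linarith

theorem Hyperbolic.splits {P : ℝ[X]} (hP : Hyperbolic P) : P.Splits := by
  refine Polynomial.Splits.of_splits_map (algebraMap ℝ ℂ) (IsAlgClosed.splits _) fun z hz => ?_
  have h1 := hP z (by
    rw [← Polynomial.eval_map_algebraMap]
    exact Polynomial.isRoot_of_mem_roots hz)
  exact ⟨z.re, Complex.ext (by simp) (by simp [h1])⟩

theorem eval_sect_pos {a : ℕ → ℝ} {n : ℕ} (ha : ∀ k ≤ n, 0 < a k) {x : ℝ} (hx : 0 ≤ x) :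
    0 < (sect a n).eval x := by
  induction n with
  | zero => simpa [sect] using ha 0 le_rfl
  | succ n ih =>
    rw [eval_sect_succ]
    have h1 := ih fun k hk => ha k (by omega)
    have h2 := ha (n + 1) le_rfl
    positivity

theorem exists_neg_roots {a : ℕ → ℝ} {n : ℕ} (ha : ∀ k ≤ n, 0 < a k)
    (h : Hyperbolic (sect a n)) : ∃ T : Multiset ℝ,
      (∀ t ∈ T, 0 < t ∧ (sect a n).eval (-t) = 0) ∧ T.card = n ∧
        ∀ k l, k + l = n → a k = a n * T.esymm l := by
  have hcoeff := coeff_sect a (le_refl n)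
  have hdeg : (sect a n).natDegree = n := le_antisymm (natDegree_sect_le a n)
    (Polynomial.le_natDegree_of_ne_zero (hcoeff ▸ (ha n le_rfl).ne'))
  refine ⟨(sect a n).roots.map Neg.neg, fun t ht => ?_, ?_, fun k l hkl => ?_⟩
  · obtain ⟨r, hr, rfl⟩ := Multiset.mem_map.1 ht
    have hr0 : (sect a n).eval r = 0 := Polynomial.isRoot_of_mem_roots hr
    refine ⟨?_, by rwa [neg_neg]⟩
    by_contra! hle
    exact (eval_sect_pos ha (by linarith : 0 ≤ r)).ne' hr0
  · rw [Multiset.card_map, ← h.splits.natDegree_eq_card_roots, hdeg]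
  · have h1 := Polynomial.coeff_eq_esymm_roots_of_splits h.splits (k := k) (by omega)
    rw [coeff_sect a (by omega), Polynomial.leadingCoeff, hdeg, hcoeff,
      show n - k = l by omega] at h1
    rw [h1, Multiset.esymm_neg, mul_assoc]

theorem normSect_shift {y : ℕ → ℝ} (h0 : y 0 = 0) (n : ℕ) (u : ℝ) :
    normSect y (n + 1) u = normSect (fun k => y (k + 1)) n u := by
  induction n generalizing u with
  | zero => simp [normSect, h0]
  | succ n ih => rw [normSect, ih, normSect]

/-- The inverse quotients of `a` of index at most `n`, extended by zero. -/
noncomputable def invQuot (a : ℕ → ℝ) (n j : ℕ) : ℝ :=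
  if 1 ≤ j ∧ j ≤ n then a (j - 1) * a (j + 1) / a j ^ 2 else 0

theorem invQuot_succ (a : ℕ → ℝ) {n j : ℕ} (hj : j < n) :
    invQuot a n (j + 1) = a j * a (j + 2) / a (j + 1) ^ 2 :=
  if_pos ⟨by omega, hj⟩

theorem four_mul_invQuot_le {a : ℕ → ℝ} {n : ℕ} (h : SectionHyperbolic a (n + 1)) {j : ℕ}
    (hj : j < n) :
    4 * invQuot a n (j + 1) ≤ 1 + 3 * invQuot a n (j + 1) * invQuot a n j := by
  obtain ⟨T, hT, hcard, he⟩ := exists_neg_roots (fun k hk => h.1 k (by omega))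
    (h.2 (j + 2) (by omega) (by omega))
  have h0 := h.1 j (by omega)
  have h1 := h.1 (j + 1) (by omega)
  have h2 := h.1 (j + 2) (by omega)
  have he1 := he (j + 1) 1 rfl
  have he2 := he j 2 rfl
  have he3 : T.esymm 3 * (a (j + 2) * a (j + 1)) = invQuot a n j * a j ^ 2 := by
    cases j with
    | zero =>
      have : T.esymm 3 = 0 := by
        rw [Multiset.esymm, Multiset.powersetCard_eq_empty _ (by omega)]
        simp
      simp [this, invQuot]
    | succ j =>
      have h3 := he j 3 rfl
      rw [invQuot_succ a (by omega), h3]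
      field_simp
  have hpos : 0 < T.esymm 1 := pos_of_mul_pos_right (he1 ▸ h1) h2.le
  have key := four_mul_esymm_two_sq_le (fun t ht => (hT t ht).1.le) hpos
  have hpos2 : 0 < T.esymm 2 := pos_of_mul_pos_right (he2 ▸ h0) h2.le
  rw [invQuot_succ a hj]
  have hy : invQuot a n j = T.esymm 3 * T.esymm 1 / T.esymm 2 ^ 2 := by
    rw [he1, he2] at he3
    field_simp
    have : a (j + 2) ^ 2 * (T.esymm 3 * T.esymm 1) =
        a (j + 2) ^ 2 * (invQuot a n j * T.esymm 2 ^ 2) := by linear_combination he3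
    linarith [mul_left_cancel₀ (by positivity) this]
  rw [hy, he1, he2]
  field_simp
  nlinarith

theorem invQuot_mem {a : ℕ → ℝ} {n : ℕ} (h : SectionHyperbolic a (n + 1)) (j : ℕ) :
    0 ≤ invQuot a n j ∧ invQuot a n j ≤ 1 / 3 := by
  induction j with
  | zero => norm_num [invQuot]
  | succ j ih =>
    rcases lt_or_ge j n with hj | hj
    · have h0 := h.1 j (by omega)
      have h1 := h.1 (j + 1) (by omega)
      have h2 := h.1 (j + 2) (by omega)
      have hpos : 0 ≤ invQuot a n (j + 1) := by
        rw [invQuot_succ a hj]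
        positivity
      have := four_mul_invQuot_le h hj
      exact ⟨hpos, by nlinarith⟩
    · rw [invQuot, if_neg (by omega)]
      norm_num

theorem exists_invQuot_eq {a : ℕ → ℝ} {n : ℕ} (h : SectionHyperbolic a (n + 1)) {j : ℕ}
    (hj : j < n) : ∃ u ∈ Set.Icc (0 : ℝ) 1,
      invQuot a n (j + 1) = u * normSect (invQuot a n) (j + 1) u := by
  obtain ⟨T, hT, -, he⟩ := exists_neg_roots (fun k hk => h.1 k (by omega))
    (h.2 (j + 2) (by omega) (by omega))
  have h0 := h.1 j (by omega)
  have h1 := h.1 (j + 1) (by omega)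
  have h2 := h.1 (j + 2) (by omega)
  have he1 := he (j + 1) 1 rfl
  have he2 := he j 2 rfl
  have hpos : 0 < T.esymm 1 := pos_of_mul_pos_right (he1 ▸ h1) h2.le
  have hle := (invQuot_mem h (j + 1)).2
  have hx := invQuot_succ a hj
  obtain ⟨t, ht, hle'⟩ := exists_esymm_two_le_mul (fun t ht => (hT t ht).1) hpos (by
    rw [hx, he1, he2] at hle
    field_simp at hle
    linarith)
  obtain ⟨ht0, hroot⟩ := hT t ht
  refine ⟨a j / (a (j + 1) * t), ⟨by positivity, ?_⟩, ?_⟩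
  · rw [div_le_one (by positivity), he1, he2, mul_assoc, mul_comm _ t]
    exact mul_le_mul_of_nonneg_left hle' h2.le
  · rw [normSect_shift (by simp [invQuot])]
    have hev := eval_sect_neg (x := fun k => invQuot a n (k + 1)) (n := j + 1)
      (fun k hk => h.1 k (by omega)) (fun k hk => invQuot_succ a (by omega)) ht0.ne'
    rw [hroot, zero_eq_mul, or_iff_right (by simp), mul_eq_zero,
      or_iff_right (by positivity), normSect] at hev
    have hu : a (j + 1) / (a (j + 1 + 1) * t) * invQuot a n (j + 1) = a j / (a (j + 1) * t) := by
      rw [hx]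
      field_simp
    rw [hu] at hev
    rw [← hu, mul_right_comm, hu]
    linear_combination invQuot a n (j + 1) * hev

theorem SectionHyperbolic.admissible {a : ℕ → ℝ} {n : ℕ} (h : SectionHyperbolic a (n + 1)) :
    Admissible n (invQuot a n) := by
  refine ⟨invQuot_mem h, by simp [invQuot], fun j hj => if_neg (by omega), fun j hj =>
    ⟨four_mul_invQuot_le h hj, ?_⟩⟩
  obtain ⟨u, hu, he⟩ := exists_invQuot_eq h hj
  exact ⟨u, hu, he.le⟩

theorem admissible_zero (n : ℕ) : Admissible n 0 :=
  ⟨fun _ => by norm_num, rfl, fun _ _ => rfl, fun _ _ =>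
    ⟨by norm_num, 0, by norm_num, by norm_num⟩⟩

/-- The sequence `(m_i)` is strictly monotone decreasing. -/
theorem stmt5 : ∀ i : ℕ, 1 ≤ i → mSeq (i + 1) < mSeq i := by
  intro i hi
  obtain ⟨y, hy, hmax⟩ := (isCompact_admissible i).exists_isMaxOn ⟨0, admissible_zero i⟩
    (continuous_apply i).continuousOn
  obtain ⟨z, hz, hyz, hlt⟩ := Admissible.exists_perturbation hy
  have hz0 : ∀ j, 0 < z j := fun j => (hz j).1
  have hsec := sectionHyperbolic_coeffOfQuot hz hlt
  have ha := coeffOfQuot_pos hz0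
  have hle : mSeq (i + 1) ≤ 1 / z i := by
    refine csInf_le ⟨0, ?_⟩ ⟨coeffOfQuot z, hsec, ?_⟩
    · rintro r ⟨a, h, rfl⟩
      have h0 := h.1 i (by omega)
      have h2 := h.1 (i + 1 + 1) le_rfl
      rw [Nat.add_sub_cancel]
      positivity
    · rw [coeffOfQuot_quot hz0 i, Nat.add_sub_cancel, one_div_div]
  have hbound : ∀ a : ℕ → ℝ, SectionHyperbolic a (i + 1) →
      0 < y i ∧ 1 / y i ≤ a i ^ 2 / (a (i - 1) * a (i + 1)) := by
    intro a h
    have h0 := h.1 (i - 1) (by omega)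
    have h1 := h.1 i (by omega)
    have h2 := h.1 (i + 1) le_rfl
    have hm : invQuot a i i ≤ y i := hmax h.admissible
    rw [invQuot, if_pos ⟨hi, le_rfl⟩] at hm
    have hpos : 0 < a (i - 1) * a (i + 1) / a i ^ 2 := by positivity
    refine ⟨hpos.trans_le hm, ?_⟩
    rw [← one_div_div (a (i - 1) * a (i + 1))]
    exact one_div_le_one_div_of_le hpos hm
  have htrunc : SectionHyperbolic (coeffOfQuot z) (i + 1) :=
    ⟨fun k hk => hsec.1 k (by omega), fun k hk hk' => hsec.2 k hk (by omega)⟩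
  have hy0 := (hbound _ htrunc).1
  calc mSeq (i + 1) ≤ 1 / z i := hle
    _ < 1 / y i := one_div_lt_one_div_of_lt hy0 hyz
    _ ≤ mSeq i := le_csInf ⟨_, _, htrunc, rfl⟩ (by
        rintro r ⟨a, h, rfl⟩
        exact (hbound a h).2)
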